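/- arXiv:1108.5504 — 5 statements merged into one kernel-verified Lean document; each statement's English description precedes it below -/
import Mathlib

section
/- Let α₁, α₂ be class-K∞ functions, let V : R^{n} → R satisfy α₁(|x|) ≤ V(x) ≤ α₂(|x|) for all x ∈ R^{n}, and let ε ∈ (0,1]. Then there exist class-K∞ functions ρ₁, ρ₂ such that for all x, e ∈ R^{n} and all η ∈ [ε, 1]: ρ₁(|(x,e)|) ≤ max{V(x), η V(x+e)} ≤ ρ₂(|(x,e)|), where |(x,e)| denotes the Euclidean norm of the concatenated vector. -/
open Set Filter

noncomputable section

/-- `γ : [0,∞) → [0,∞)` is of class `K∞`: continuous, zero at zero, strictly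
increasing and unbounded. -/
structure ClassKInf (γ : ℝ → ℝ) : Prop where
  cont : ContinuousOn γ (Set.Ici 0)
  zero : γ 0 = 0
  strictMono : StrictMonoOn γ (Set.Ici 0)
  unbounded : Filter.Tendsto γ Filter.atTop Filter.atTop

theorem ClassKInf.mono {α : ℝ → ℝ} (h : ClassKInf α) {a b : ℝ} (ha : 0 ≤ a) (hab : a ≤ b) :
    α a ≤ α b :=
  h.strictMono.monotoneOn ha (ha.trans hab) hab

theorem ClassKInf.nonneg {α : ℝ → ℝ} (h : ClassKInf α) {a : ℝ} (ha : 0 ≤ a) : 0 ≤ α a :=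
  h.zero ▸ h.mono le_rfl ha

/-- Class `K∞` is stable under positive rescaling of the argument and of the value. -/
theorem ClassKInf.rescale {α : ℝ → ℝ} (h : ClassKInf α) {c k : ℝ} (hc : 0 < c) (hk : 0 < k) :
    ClassKInf fun s => c * α (k * s) where
  cont := continuousOn_const.mul <| h.cont.comp (continuousOn_const.mul continuousOn_id)
    fun _ hs => mul_nonneg hk.le hs
  zero := by simp [h.zero]
  strictMono _ ha _ hb hab := mul_lt_mul_of_pos_left
    (h.strictMono (mul_nonneg hk.le ha) (mul_nonneg hk.le hb) (mul_lt_mul_of_pos_left hab hk)) hc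
  unbounded := (h.unbounded.comp (tendsto_id.const_mul_atTop hk)).const_mul_atTop hc

/-- If `α₁(|x|) ≤ V(x) ≤ α₂(|x|)` with `α₁, α₂` of class `K∞` and `ε ∈ (0,1]`, then
`max{V(x), η V(x+e)}` is, uniformly over `η ∈ [ε,1]`, sandwiched between class-`K∞`
functions of the Euclidean norm of the concatenated vector `(x,e)`. -/
theorem max_V_etaV_sandwich
    {n : ℕ}
    (α₁ α₂ : ℝ → ℝ) (hα₁ : ClassKInf α₁) (hα₂ : ClassKInf α₂)
    (V : EuclideanSpace ℝ (Fin n) → ℝ)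
    (hVbound : ∀ x : EuclideanSpace ℝ (Fin n), α₁ ‖x‖ ≤ V x ∧ V x ≤ α₂ ‖x‖)
    (ε : ℝ) (hε : ε ∈ Set.Ioc (0:ℝ) 1) :
    ∃ ρ₁ ρ₂ : ℝ → ℝ, ClassKInf ρ₁ ∧ ClassKInf ρ₂ ∧
      ∀ (x e : EuclideanSpace ℝ (Fin n)), ∀ η ∈ Set.Icc ε 1,
        ρ₁ (Real.sqrt (‖x‖ ^ 2 + ‖e‖ ^ 2)) ≤ max (V x) (η * V (x + e)) ∧
        max (V x) (η * V (x + e)) ≤ ρ₂ (Real.sqrt (‖x‖ ^ 2 + ‖e‖ ^ 2)) := by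
  obtain ⟨hε0, hε1⟩ := hε
  refine ⟨fun s => ε * α₁ (1 / 3 * s), fun s => 1 * α₂ (2 * s),
    hα₁.rescale hε0 (by norm_num), hα₂.rescale one_pos two_pos, ?_⟩
  rintro x e η ⟨hεη, hη1⟩
  have hV0 (y : EuclideanSpace ℝ (Fin n)) : 0 ≤ V y :=
    (hα₁.nonneg (norm_nonneg y)).trans (hVbound y).1
  set s := Real.sqrt (‖x‖ ^ 2 + ‖e‖ ^ 2)
  have hs0 : 0 ≤ s := Real.sqrt_nonneg _
  have hx0 := norm_nonneg x
  have he0 := norm_nonneg e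
  have hxs : ‖x‖ ≤ s := Real.le_sqrt_of_sq_le (by nlinarith)
  have hes : ‖e‖ ≤ s := Real.le_sqrt_of_sq_le (by nlinarith)
  have hsle : s ≤ ‖x‖ + ‖e‖ :=
    Real.sqrt_le_iff.2 ⟨by positivity, by nlinarith [mul_nonneg hx0 he0]⟩
  have htri : ‖x + e‖ ≤ ‖x‖ + ‖e‖ := norm_add_le x e
  have he : ‖e‖ ≤ ‖x + e‖ + ‖x‖ := by simpa using norm_sub_le (x + e) x
  have h3 : 0 ≤ 1 / 3 * s := by positivity
  constructor
  · rcases le_total (1 / 3 * s) ‖x‖ with h | h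
    · exact le_max_of_le_left <| (mul_le_of_le_one_left (hα₁.nonneg h3) hε1).trans <|
        (hα₁.mono h3 h).trans (hVbound x).1
    · exact le_max_of_le_right <| mul_le_mul hεη
        ((hα₁.mono h3 (by linarith)).trans (hVbound _).1) (hα₁.nonneg h3) (hε0.le.trans hεη)
  · simp only [one_mul]
    refine max_le ((hVbound x).2.trans (hα₂.mono hx0 (by linarith))) ?_
    exact (mul_le_of_le_one_left (hV0 _) hη1).trans <|
      (hVbound _).2.trans (hα₂.mono (norm_nonneg _) (by linarith))

end
end

section
/- Let α be a class-K∞ function that is locally Lipschitz on [0,∞). Then there exists a class-KL function β satisfying the semigroup property β(β(s, t₁), t₂) = β(s, t₁ + t₂) for all s, t₁, t₂ ≥ 0, such that every differentiable function u : [0,T] → [0,∞) with u'(t) ≤ −α(u(t)) for all t ∈ [0,T] satisfies u(t) ≤ β(u(0), t) for all t ∈ [0,T]. -/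
open Set Filter

noncomputable section

/-- `β : [0,∞)² → [0,∞)` is of class `KL`: jointly continuous, `β (·, t)` is of
class `K` for each `t ≥ 0`, and `β (s, ·)` decreases to zero for each `s > 0`. -/
structure ClassKL (β : ℝ → ℝ → ℝ) : Prop where
  nonneg : ∀ s ≥ (0:ℝ), ∀ t ≥ (0:ℝ), 0 ≤ β s t
  cont : ContinuousOn (fun p : ℝ × ℝ => β p.1 p.2) (Set.Ici 0 ×ˢ Set.Ici 0)
  zero : ∀ t ≥ (0:ℝ), β 0 t = 0
  strictMono : ∀ t ≥ (0:ℝ), StrictMonoOn (fun s => β s t) (Set.Ici 0)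
  antitone : ∀ s > (0:ℝ), AntitoneOn (fun t => β s t) (Set.Ici 0)
  tendsto_zero : ∀ s > (0:ℝ), Filter.Tendsto (fun t => β s t) Filter.atTop (nhds 0)

open Topology

theorem ClassKInf.pos {α : ℝ → ℝ} (hα : ClassKInf α) {s : ℝ} (hs : 0 < s) : 0 < α s := by
  simpa [hα.zero] using hα.strictMono (mem_Ici.2 le_rfl) (mem_Ici.2 hs.le) hs

/-- Separation of variables: `1 / α` has a primitive on `(0,∞)`. -/
theorem ClassKInf.exists_primitive_inv {α : ℝ → ℝ} (hα : ClassKInf α) :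
    ∃ η : ℝ → ℝ, ∀ s > 0, HasDerivAt η (α s)⁻¹ s := by
  have hc : ContinuousOn (fun r => (α r)⁻¹) (Ioi 0) :=
    (hα.cont.mono Ioi_subset_Ici_self).inv₀ fun r hr => (hα.pos hr).ne'
  refine ⟨fun s => ∫ r in (1 : ℝ)..s, (α r)⁻¹, fun s hs => ?_⟩
  refine intervalIntegral.integral_hasDerivAt_right ?_
    (hc.stronglyMeasurableAtFilter isOpen_Ioi s hs) (hc.continuousAt (Ioi_mem_nhds hs))
  refine (hc.mono fun r hr => ?_).intervalIntegrable
  exact lt_of_lt_of_le (lt_min one_pos hs) hr.1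

theorem LocallyLipschitzOn.exists_le_mul {α : ℝ → ℝ} (h : LocallyLipschitzOn (Ici 0) α)
    (h0 : α 0 = 0) : ∃ L > 0, ∃ δ > 0, ∀ s ∈ Ioc (0 : ℝ) δ, α s ≤ L * s := by
  obtain ⟨K, t, ht, hK⟩ := h (mem_Ici.2 le_rfl)
  obtain ⟨δ, hδ, hsub⟩ := mem_nhdsGE_iff_exists_Icc_subset.1 ht
  refine ⟨K + 1, by positivity, δ, hδ, fun s hs => ?_⟩
  have := hK.dist_le_mul s (hsub ⟨hs.1.le, hs.2⟩) 0 (hsub ⟨le_rfl, le_of_lt hδ⟩)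
  rw [h0, Real.dist_eq, Real.dist_eq, sub_zero, sub_zero, abs_of_pos hs.1] at this
  nlinarith [le_abs_self (α s), hs.1]

/-- A primitive of `1 / α` diverges to `-∞` at zero when `α` grows at most linearly there. -/
theorem tendsto_primitive_inv_atBot {α η : ℝ → ℝ} (hpos : ∀ s > 0, 0 < α s)
    (hη : ∀ s > 0, HasDerivAt η (α s)⁻¹ s) {L δ : ℝ} (hL : 0 < L) (hδ : 0 < δ)
    (hle : ∀ s ∈ Ioc 0 δ, α s ≤ L * s) : Tendsto η (𝓝[>] 0) atBot := by
  have hder : ∀ s > 0, HasDerivAt (fun s => η s - L⁻¹ * Real.log s) ((α s)⁻¹ - L⁻¹ * s⁻¹) s :=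
    fun s hs => (hη s hs).sub ((Real.hasDerivAt_log hs.ne').const_mul _)
  have hmono : MonotoneOn (fun s => η s - L⁻¹ * Real.log s) (Ioc 0 δ) := by
    refine monotoneOn_of_deriv_nonneg (convex_Ioc 0 δ)
      (fun s hs => (hder s hs.1).continuousAt.continuousWithinAt)
      (fun s hs => ?_) (fun s hs => ?_) <;> rw [interior_Ioc] at hs
    · exact (hder s hs.1).differentiableAt.differentiableWithinAt
    · rw [(hder s hs.1).deriv, ← mul_inv, sub_nonneg]
      exact inv_anti₀ (hpos s hs.1) (hle s ⟨hs.1, hs.2.le⟩)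
  have hlim : Tendsto (fun s => (η δ - L⁻¹ * Real.log δ) + L⁻¹ * Real.log s) (𝓝[>] 0) atBot :=
    tendsto_atBot_add_const_left _ _
      ((tendsto_const_mul_atBot_of_pos (inv_pos.2 hL)).2 Real.tendsto_log_nhdsGT_zero)
  refine tendsto_atBot_mono' _ ?_ hlim
  filter_upwards [Ioc_mem_nhdsGT hδ] with s hs
  linarith [hmono hs ⟨hδ, le_rfl⟩ hs.2]

/-- The flow `β(s,t) = η⁻¹(η(s) - t)` generated by a time coordinate `η` on `(0,∞)`. -/
structure IsTimeFlow (η : ℝ → ℝ) (β : ℝ → ℝ → ℝ) : Prop where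
  zero : ∀ t, β 0 t = 0
  pos : ∀ s > 0, ∀ t ≥ 0, 0 < β s t
  eq : ∀ s > 0, ∀ t ≥ 0, η (β s t) = η s - t

theorem exists_isTimeFlow {η : ℝ → ℝ} (hc : ContinuousOn η (Ioi 0))
    (hbot : Tendsto η (𝓝[>] 0) atBot) : ∃ β, IsTimeFlow η β := by
  have key : ∀ s t : ℝ, ∃ r, (s = 0 → r = 0) ∧ (0 < s → 0 ≤ t → 0 < r ∧ η r = η s - t) := by
    intro s t
    by_cases h : 0 < s ∧ 0 ≤ t
    · obtain ⟨hs, ht⟩ := h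
      obtain ⟨a, hηa, ha⟩ :=
        ((hbot.eventually (eventually_le_atBot (η s - t))).and (Ioc_mem_nhdsGT hs)).exists
      have hsub : Icc a s ⊆ Ioi 0 := fun r hr => lt_of_lt_of_le ha.1 hr.1
      obtain ⟨r, hr, hr'⟩ :=
        intermediate_value_Icc ha.2 (hc.mono hsub) ⟨hηa, sub_le_self (η s) ht⟩
      exact ⟨r, fun h => absurd h hs.ne', fun _ _ => ⟨hsub hr, hr'⟩⟩
    · exact ⟨0, fun _ => rfl, fun hs ht => absurd ⟨hs, ht⟩ h⟩
  choose β h0 h1 using key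
  exact ⟨β, fun t => h0 0 t rfl, fun s hs t ht => (h1 s t hs ht).1,
    fun s hs t ht => (h1 s t hs ht).2⟩

namespace IsTimeFlow

variable {η : ℝ → ℝ} {β : ℝ → ℝ → ℝ}

theorem nonneg (h : IsTimeFlow η β) {s t : ℝ} (hs : 0 ≤ s) (ht : 0 ≤ t) : 0 ≤ β s t := by
  rcases hs.eq_or_lt with rfl | hs
  · exact (h.zero t).ge
  · exact (h.pos s hs t ht).le

theorem le_self (h : IsTimeFlow η β) (hη : StrictMonoOn η (Ioi 0)) {s t : ℝ} (hs : 0 ≤ s)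
    (ht : 0 ≤ t) : β s t ≤ s := by
  rcases hs.eq_or_lt with rfl | hs
  · exact (h.zero t).le
  · rw [← hη.le_iff_le (h.pos s hs t ht) hs, h.eq s hs t ht]
    exact sub_le_self _ ht

theorem semigroup (h : IsTimeFlow η β) (hη : StrictMonoOn η (Ioi 0)) {s t₁ t₂ : ℝ} (hs : 0 ≤ s)
    (h₁ : 0 ≤ t₁) (h₂ : 0 ≤ t₂) : β (β s t₁) t₂ = β s (t₁ + t₂) := by
  rcases hs.eq_or_lt with rfl | hs
  · simp only [h.zero]
  · have hp := h.pos s hs t₁ h₁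
    refine hη.injOn (h.pos _ hp _ h₂) (h.pos s hs _ (add_nonneg h₁ h₂)) ?_
    rw [h.eq _ hp _ h₂, h.eq s hs _ h₁, h.eq s hs _ (add_nonneg h₁ h₂)]
    ring

theorem continuousOn (h : IsTimeFlow η β) (hη : StrictMonoOn η (Ioi 0))
    (hc : ContinuousOn η (Ioi 0)) :
    ContinuousOn (fun p : ℝ × ℝ => β p.1 p.2) (Ici 0 ×ˢ Ici 0) := by
  rintro ⟨s, t⟩ ⟨hs, ht⟩
  simp only [mem_Ici] at hs ht
  have hfst : Tendsto (fun p : ℝ × ℝ => p.1) (𝓝[Ici 0 ×ˢ Ici 0] (s, t)) (𝓝 s) :=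
    continuous_fst.continuousAt.continuousWithinAt
  have hsnd : Tendsto (fun p : ℝ × ℝ => p.2) (𝓝[Ici 0 ×ˢ Ici 0] (s, t)) (𝓝 t) :=
    continuous_snd.continuousAt.continuousWithinAt
  change Tendsto _ _ (𝓝 (β s t))
  rcases hs.eq_or_lt with rfl | hs
  · rw [h.zero]
    refine tendsto_of_tendsto_of_tendsto_of_le_of_le' tendsto_const_nhds hfst ?_ ?_ <;>
      filter_upwards [self_mem_nhdsWithin] with p hp
    · exact h.nonneg hp.1 hp.2
    · exact h.le_self hη hp.1 hp.2
  · have hlim : Tendsto (fun p : ℝ × ℝ => η p.1 - p.2) (𝓝[Ici 0 ×ˢ Ici 0] (s, t))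
        (𝓝 (η s - t)) :=
      ((hc.continuousAt (Ioi_mem_nhds hs)).tendsto.comp hfst).sub hsnd
    have hr := h.pos s hs t ht
    rw [← h.eq s hs t ht] at hlim
    refine tendsto_order.2 ⟨fun a ha => ?_, fun b hb => ?_⟩
    · rcases le_or_gt a 0 with ha0 | ha0
      · filter_upwards [self_mem_nhdsWithin, hfst.eventually (lt_mem_nhds hs)] with p hp hp1
        exact ha0.trans_lt (h.pos _ hp1 _ hp.2)
      · filter_upwards [self_mem_nhdsWithin, hfst.eventually (lt_mem_nhds hs),
          hlim.eventually (lt_mem_nhds (hη ha0 hr ha))] with p hp hp1 hp2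
        rwa [← hη.lt_iff_lt ha0 (h.pos _ hp1 _ hp.2), h.eq _ hp1 _ hp.2]
    · have hb0 : 0 < b := hr.trans hb
      filter_upwards [self_mem_nhdsWithin, hfst.eventually (lt_mem_nhds hs),
        hlim.eventually (gt_mem_nhds (hη hr hb0 hb))] with p hp hp1 hp2
      rwa [← hη.lt_iff_lt (h.pos _ hp1 _ hp.2) hb0, h.eq _ hp1 _ hp.2]

theorem classKL (h : IsTimeFlow η β) (hη : StrictMonoOn η (Ioi 0))
    (hc : ContinuousOn η (Ioi 0)) : ClassKL β where
  nonneg _ hs _ ht := h.nonneg hs ht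
  cont := h.continuousOn hη hc
  zero t _ := h.zero t
  strictMono t ht := by
    intro a ha b _ hab
    have hb0 : 0 < b := lt_of_le_of_lt ha hab
    rcases (mem_Ici.1 ha).eq_or_lt with rfl | ha
    · simpa only [h.zero] using h.pos b hb0 t ht
    · change β a t < β b t
      rw [← hη.lt_iff_lt (h.pos a ha t ht) (h.pos b hb0 t ht), h.eq a ha t ht, h.eq b hb0 t ht]
      exact sub_lt_sub_right (hη ha hb0 hab) t
  antitone s hs := by
    intro a ha b hb hab
    change β s b ≤ β s a
    rw [← hη.le_iff_le (h.pos s hs b hb) (h.pos s hs a ha), h.eq s hs a ha, h.eq s hs b hb]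
    exact sub_le_sub_left hab _
  tendsto_zero s hs := by
    refine tendsto_order.2 ⟨fun a ha => ?_, fun b hb => ?_⟩
    · filter_upwards [eventually_ge_atTop 0] with t ht
      exact ha.trans (h.pos s hs t ht)
    · filter_upwards [eventually_ge_atTop 0, eventually_gt_atTop (η s - η b)] with t ht ht'
      rw [← hη.lt_iff_lt (h.pos s hs t ht) hb, h.eq s hs t ht]
      linarith

end IsTimeFlow

theorem antitoneOn_Icc_of_hasDerivWithinAt_nonpos {T : ℝ} {u u' : ℝ → ℝ}
    (hu : ∀ t ∈ Icc 0 T, HasDerivWithinAt u (u' t) (Icc 0 T) t)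
    (hu' : ∀ t ∈ Icc 0 T, u' t ≤ 0) : AntitoneOn u (Icc 0 T) := by
  refine antitoneOn_of_hasDerivWithinAt_nonpos (convex_Icc 0 T)
    (fun t ht => (hu t ht).continuousWithinAt)
    (fun t ht => (hu t (interior_subset ht)).mono interior_subset)
    (fun t ht => hu' t (interior_subset ht))

/-- In the time coordinate `η`, a positive subsolution of `u' = -α(u)` descends at unit speed. -/
theorem primitive_inv_le_sub {α η u u' : ℝ → ℝ} {T : ℝ} (hpos : ∀ s > 0, 0 < α s)
    (hη : ∀ s > 0, HasDerivAt η (α s)⁻¹ s) (hT : 0 ≤ T) (hu0 : ∀ t ∈ Icc 0 T, 0 < u t)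
    (hu : ∀ t ∈ Icc 0 T, HasDerivWithinAt u (u' t) (Icc 0 T) t)
    (hle : ∀ t ∈ Icc 0 T, u' t ≤ -α (u t)) : η (u T) ≤ η (u 0) - T := by
  have hanti : AntitoneOn (fun t => η (u t) + t) (Icc 0 T) := by
    refine antitoneOn_Icc_of_hasDerivWithinAt_nonpos (u' := fun t => (α (u t))⁻¹ * u' t + 1)
      (fun t ht => ((hη _ (hu0 t ht)).comp_hasDerivWithinAt t (hu t ht)).add
        (hasDerivWithinAt_id t _)) (fun t ht => ?_)
    have hα := hpos _ (hu0 t ht)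
    have := mul_le_mul_of_nonneg_left (hle t ht) (inv_pos.2 hα).le
    rw [mul_neg, inv_mul_cancel₀ hα.ne'] at this
    linarith
  have := hanti ⟨le_rfl, hT⟩ ⟨hT, le_rfl⟩ hT
  simp only [add_zero] at this
  linarith

/-- **Comparison principle**: for a locally Lipschitz class-`K∞` function `α`, there
is a class-`KL` function `β` with the semigroup property `β(β(s,t₁),t₂) = β(s,t₁+t₂)`
such that any nonnegative differentiable `u` on `[0,T]` with `u' ≤ -α ∘ u` satisfies
`u(t) ≤ β(u(0), t)`. -/
theorem comparison_principle
    (α : ℝ → ℝ) (hα : ClassKInf α) (hαLip : LocallyLipschitzOn (Set.Ici 0) α) :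
    ∃ β : ℝ → ℝ → ℝ, ClassKL β ∧
      (∀ s ≥ (0:ℝ), ∀ t₁ ≥ (0:ℝ), ∀ t₂ ≥ (0:ℝ), β (β s t₁) t₂ = β s (t₁ + t₂)) ∧
      ∀ (T : ℝ) (u u' : ℝ → ℝ),
        (∀ t ∈ Set.Icc 0 T, 0 ≤ u t) →
        (∀ t ∈ Set.Icc 0 T, HasDerivWithinAt u (u' t) (Set.Icc 0 T) t) →
        (∀ t ∈ Set.Icc 0 T, u' t ≤ -α (u t)) →
        ∀ t ∈ Set.Icc 0 T, u t ≤ β (u 0) t := by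
  obtain ⟨η, hη⟩ := hα.exists_primitive_inv
  have hpos : ∀ s > 0, 0 < α s := fun s hs => hα.pos hs
  have hc : ContinuousOn η (Ioi 0) := fun s hs => (hη s hs).continuousAt.continuousWithinAt
  have hmono : StrictMonoOn η (Ioi 0) := by
    refine strictMonoOn_of_deriv_pos (convex_Ioi 0) hc fun s hs => ?_
    rw [interior_Ioi] at hs
    rw [(hη s hs).deriv]
    exact inv_pos.2 (hpos s hs)
  obtain ⟨L, hL, δ, hδ, hlin⟩ := hαLip.exists_le_mul hα.zero
  obtain ⟨β, hβ⟩ := exists_isTimeFlow hc (tendsto_primitive_inv_atBot hpos hη hL hδ hlin)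
  refine ⟨β, hβ.classKL hmono hc, fun s hs t₁ h₁ t₂ h₂ => hβ.semigroup hmono hs h₁ h₂, ?_⟩
  intro T u u' hu0 hu hle t ht
  have hanti : AntitoneOn u (Icc 0 T) := by
    refine antitoneOn_Icc_of_hasDerivWithinAt_nonpos hu fun r hr => (hle r hr).trans ?_
    rw [neg_nonpos, ← hα.zero]
    exact hα.strictMono.monotoneOn (mem_Ici.2 le_rfl) (hu0 r hr) (hu0 r hr)
  have h0 : (0 : ℝ) ∈ Icc 0 T := ⟨le_rfl, ht.1.trans ht.2⟩
  rcases (hu0 t ht).eq_or_lt with hut | hut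
  · rw [← hut]
    exact hβ.nonneg (hu0 0 h0) ht.1
  · have hsub : Icc 0 t ⊆ Icc 0 T := Icc_subset_Icc_right ht.2
    have hu0' : ∀ r ∈ Icc 0 t, 0 < u r := fun r hr =>
      hut.trans_le (hanti (hsub hr) ht hr.2)
    have hs := hu0' 0 ⟨le_rfl, ht.1⟩
    rw [← hmono.le_iff_le hut (hβ.pos _ hs t ht.1), hβ.eq _ hs t ht.1]
    exact primitive_inv_le_sub hpos hη ht.1 hu0' (fun r hr => (hu r (hsub hr)).mono hsub)
      (fun r hr => hle r (hsub hr))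

end
end

section
/- Let x, e : I → R^{n} be functions on an open interval I ⊆ R that are differentiable at t₀ ∈ I, with e'(t₀) = −x'(t₀), x(t₀) ≠ 0 and e(t₀) ≠ 0, and suppose ‖x'(t₀)‖ ≤ L₁(‖x(t₀)‖ + ‖e(t₀)‖) for some L₁ ≥ 0, where ‖·‖ is the Euclidean norm. Then the function r : t ↦ ‖e(t)‖/‖x(t)‖ is differentiable at t₀ and r'(t₀) ≤ L₁ (1 + r(t₀))². -/
open Set

/-- Away from its zeros, the norm of a differentiable curve is differentiable, with derivative
bounded by the speed of the curve. -/
theorem HasDerivAt.exists_hasDerivAt_norm_abs_le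
    {F : Type*} [NormedAddCommGroup F] [InnerProductSpace ℝ F] {f : ℝ → F} {f' : F} {t : ℝ}
    (hf : HasDerivAt f f' t) (h0 : f t ≠ 0) :
    ∃ d : ℝ, HasDerivAt (fun s => ‖f s‖) d t ∧ |d| ≤ ‖f'‖ := by
  have hnorm : DifferentiableAt ℝ (norm : F → ℝ) (f t) :=
    (contDiffAt_norm (n := 1) ℝ h0).differentiableAt one_ne_zero
  refine ⟨fderiv ℝ norm (f t) f', hnorm.hasFDerivAt.comp_hasDerivAt t hf, ?_⟩
  simpa using (fderiv ℝ norm (f t)).le_of_opNorm_le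
    (norm_fderiv_le_of_lipschitz ℝ (lipschitzWith_one_norm (E := F))) f'

/-- If `x, e` are differentiable at `t₀` with `e' = -x'` there, `x(t₀) ≠ 0`,
`e(t₀) ≠ 0` and `‖x'(t₀)‖ ≤ L₁(‖x(t₀)‖ + ‖e(t₀)‖)`, then `t ↦ ‖e(t)‖/‖x(t)‖` is
differentiable at `t₀` with derivative at most `L₁ (1 + ‖e(t₀)‖/‖x(t₀)‖)²`. -/
theorem deriv_ratio_bound_zoh
    {n : ℕ} (I : Set ℝ) (hI : IsOpen I) (t₀ : ℝ) (ht₀ : t₀ ∈ I)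
    (x e : ℝ → EuclideanSpace ℝ (Fin n)) (xd ed : EuclideanSpace ℝ (Fin n))
    (hx : HasDerivAt x xd t₀) (he : HasDerivAt e ed t₀)
    (hed : ed = -xd)
    (hx0 : x t₀ ≠ 0) (he0 : e t₀ ≠ 0)
    (L₁ : ℝ) (hL₁ : 0 ≤ L₁)
    (hbound : ‖xd‖ ≤ L₁ * (‖x t₀‖ + ‖e t₀‖)) :
    ∃ rd : ℝ, HasDerivAt (fun t => ‖e t‖ / ‖x t‖) rd t₀ ∧
      rd ≤ L₁ * (1 + ‖e t₀‖ / ‖x t₀‖) ^ 2 := by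
  subst hed
  obtain ⟨dx, hdx, hdx_le⟩ := hx.exists_hasDerivAt_norm_abs_le hx0
  obtain ⟨de, hde, hde_le⟩ := he.exists_hasDerivAt_norm_abs_le he0
  rw [norm_neg] at hde_le
  have hX : 0 < ‖x t₀‖ := norm_pos_iff.2 hx0
  refine ⟨_, hde.div hdx hX.ne', ?_⟩
  calc (de * ‖x t₀‖ - ‖e t₀‖ * dx) / ‖x t₀‖ ^ 2
      ≤ (‖xd‖ * ‖x t₀‖ - ‖e t₀‖ * -‖xd‖) / ‖x t₀‖ ^ 2 := by
        gcongr
        · exact (abs_le.1 hde_le).2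
        · exact (abs_le.1 hdx_le).1
    _ = ‖xd‖ * (‖x t₀‖ + ‖e t₀‖) / ‖x t₀‖ ^ 2 := by ring
    _ ≤ L₁ * (‖x t₀‖ + ‖e t₀‖) * (‖x t₀‖ + ‖e t₀‖) / ‖x t₀‖ ^ 2 := by gcongr
    _ = L₁ * (1 + ‖e t₀‖ / ‖x t₀‖) ^ 2 := by field_simp
end

section
/- Let x, e : I → R^{n_x}, R^{n_e} be functions on an open interval I ⊆ R that are differentiable at t₀ ∈ I, with x(t₀) ≠ 0 and e(t₀) ≠ 0, and suppose ‖x'(t₀)‖ ≤ L₁(‖x(t₀)‖ + ‖e(t₀)‖) and ‖e'(t₀)‖ ≤ L₃(‖x(t₀)‖ + ‖e(t₀)‖) for some L₁, L₃ ≥ 0, where ‖·‖ is the Euclidean norm. Then the function r : t ↦ ‖e(t)‖/‖x(t)‖ is differentiable at t₀ and r'(t₀) ≤ L₃ + (L₁ + L₃) r(t₀) + L₁ r(t₀)². -/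
open Set

/-- If `x, e` are differentiable at `t₀` with `x(t₀) ≠ 0`, `e(t₀) ≠ 0`,
`‖x'(t₀)‖ ≤ L₁(‖x(t₀)‖ + ‖e(t₀)‖)` and `‖e'(t₀)‖ ≤ L₃(‖x(t₀)‖ + ‖e(t₀)‖)`, then
`t ↦ ‖e(t)‖/‖x(t)‖` is differentiable at `t₀` with derivative at most
`L₃ + (L₁ + L₃) r(t₀) + L₁ r(t₀)²` where `r(t₀) = ‖e(t₀)‖/‖x(t₀)‖`. -/
theorem deriv_ratio_bound_general
    {nx ne : ℕ} (I : Set ℝ) (hI : IsOpen I) (t₀ : ℝ) (ht₀ : t₀ ∈ I)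
    (x : ℝ → EuclideanSpace ℝ (Fin nx)) (e : ℝ → EuclideanSpace ℝ (Fin ne))
    (xd : EuclideanSpace ℝ (Fin nx)) (ed : EuclideanSpace ℝ (Fin ne))
    (hx : HasDerivAt x xd t₀) (he : HasDerivAt e ed t₀)
    (hx0 : x t₀ ≠ 0) (he0 : e t₀ ≠ 0)
    (L₁ L₃ : ℝ) (hL₁ : 0 ≤ L₁) (hL₃ : 0 ≤ L₃)
    (hboundx : ‖xd‖ ≤ L₁ * (‖x t₀‖ + ‖e t₀‖))
    (hbounde : ‖ed‖ ≤ L₃ * (‖x t₀‖ + ‖e t₀‖)) :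
    ∃ rd : ℝ, HasDerivAt (fun t => ‖e t‖ / ‖x t‖) rd t₀ ∧
      rd ≤ L₃ + (L₁ + L₃) * (‖e t₀‖ / ‖x t₀‖) + L₁ * (‖e t₀‖ / ‖x t₀‖) ^ 2 := by
  obtain ⟨dx, hdx, hdx_le⟩ := hx.exists_hasDerivAt_norm_abs_le hx0
  obtain ⟨de, hde, hde_le⟩ := he.exists_hasDerivAt_norm_abs_le he0
  have hpos : 0 < ‖x t₀‖ := norm_pos_iff.mpr hx0
  refine ⟨_, hde.div hdx hpos.ne', ?_⟩
  have hnum : de * ‖x t₀‖ - ‖e t₀‖ * dx ≤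
      L₃ * (‖x t₀‖ + ‖e t₀‖) * ‖x t₀‖ + ‖e t₀‖ * (L₁ * (‖x t₀‖ + ‖e t₀‖)) := by
    have h₁ := mul_le_mul_of_nonneg_right ((le_abs_self de).trans (hde_le.trans hbounde)) hpos.le
    have h₂ := mul_le_mul_of_nonneg_left ((neg_le_abs dx).trans (hdx_le.trans hboundx))
      (norm_nonneg (e t₀))
    linarith
  refine (div_le_div_of_nonneg_right hnum (sq_nonneg _)).trans_eq ?_
  field_simp
  ring
end

section
/- Let c > 0 and let u, v : [0,T] → [0,∞) be differentiable functions such that for every t ∈ [0,T]: if u(t) ≥ v(t) then u'(t) ≤ −c·u(t), and if v(t) ≥ u(t) then v'(t) ≤ −c·v(t). Then max{u(t), v(t)} ≤ e^{−ct} · max{u(0), v(0)} for all t ∈ [0,T]. -/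
open Set

/-- A function lying below `M` at `x`, and whose right derivative is less than `r > 0` in case
of equality, stays below the line of slope `r` through `(x, M)` just to the right of `x`. -/
theorem eventually_lt_add_mul_of_hasDerivWithinAt {p : ℝ → ℝ} {p' x M r : ℝ} (hr : 0 < r)
    (hp : HasDerivWithinAt p p' (Ioi x) x) (hM : p x ≤ M) (hp' : p x = M → p' < r) :
    ∀ᶠ z in nhdsWithin x (Ioi x), p z < M + r * (z - x) := by
  rcases hM.lt_or_eq with h | h
  · filter_upwards [hp.continuousWithinAt.eventually_lt_const h, self_mem_nhdsWithin] with z hz hxz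
    have := mul_pos hr (sub_pos.2 hxz)
    linarith
  · have hslope := (hasDerivWithinAt_iff_tendsto_slope' self_notMem_Ioi).1 hp
    filter_upwards [hslope.eventually_lt_const (hp' h), self_mem_nhdsWithin] with z hz hxz
    rw [slope_def_field, div_lt_iff₀ (sub_pos.2 hxz)] at hz
    linarith

/-- If each of `p`, `q` has nonpositive derivative wherever it attains `max p q`, then `max p q`
is bounded by its initial value. -/
theorem max_le_max_left_endpoint {p q p' q' : ℝ → ℝ} {a b : ℝ}
    (hp : ∀ t ∈ Icc a b, HasDerivWithinAt p (p' t) (Icc a b) t)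
    (hq : ∀ t ∈ Icc a b, HasDerivWithinAt q (q' t) (Icc a b) t)
    (hp' : ∀ t ∈ Icc a b, q t ≤ p t → p' t ≤ 0)
    (hq' : ∀ t ∈ Icc a b, p t ≤ q t → q' t ≤ 0) :
    ∀ t ∈ Icc a b, max (p t) (q t) ≤ max (p a) (q a) := by
  have hpc : ContinuousOn p (Icc a b) := fun t ht => (hp t ht).continuousWithinAt
  have hqc : ContinuousOn q (Icc a b) := fun t ht => (hq t ht).continuousWithinAt
  refine image_le_of_liminf_slope_right_le_deriv_boundary (f := fun t => max (p t) (q t))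
    (B := fun _ => max (p a) (q a)) (B' := fun _ => 0) (hpc.sup hqc) le_rfl continuousOn_const
    (fun x _ => hasDerivWithinAt_const x _ _) fun x hx r hr => Filter.Eventually.frequently ?_
  have hx' := Ico_subset_Icc_self hx
  have hmem : Icc a b ∈ nhdsWithin x (Ioi x) := Icc_mem_nhdsGT_of_mem hx
  filter_upwards [self_mem_nhdsWithin,
    eventually_lt_add_mul_of_hasDerivWithinAt hr ((hp x hx').mono_of_mem_nhdsWithin hmem)
      (le_max_left _ (q x)) fun h => (hp' x hx' (max_eq_left_iff.1 h.symm)).trans_lt hr,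
    eventually_lt_add_mul_of_hasDerivWithinAt hr ((hq x hx').mono_of_mem_nhdsWithin hmem)
      (le_max_right (p x) _) fun h => (hq' x hx' (max_eq_right_iff.1 h.symm)).trans_lt hr]
    with z hxz hpz hqz
  rw [slope_def_field, div_lt_iff₀ (sub_pos.2 hxz), sub_lt_iff_lt_add']
  exact max_lt hpz hqz

/-- If `u, v : [0,T] → [0,∞)` are differentiable with `u' ≤ -c u` whenever `u ≥ v`
and `v' ≤ -c v` whenever `v ≥ u`, then `max{u(t), v(t)} ≤ e^{-c t} max{u(0), v(0)}`
on `[0,T]`. -/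
theorem max_exp_decay
    (c T : ℝ) (hc : 0 < c)
    (u v u' v' : ℝ → ℝ)
    (hu_nonneg : ∀ t ∈ Set.Icc 0 T, 0 ≤ u t)
    (hv_nonneg : ∀ t ∈ Set.Icc 0 T, 0 ≤ v t)
    (hu : ∀ t ∈ Set.Icc 0 T, HasDerivWithinAt u (u' t) (Set.Icc 0 T) t)
    (hv : ∀ t ∈ Set.Icc 0 T, HasDerivWithinAt v (v' t) (Set.Icc 0 T) t)
    (hu_decay : ∀ t ∈ Set.Icc 0 T, v t ≤ u t → u' t ≤ -c * u t)
    (hv_decay : ∀ t ∈ Set.Icc 0 T, u t ≤ v t → v' t ≤ -c * v t) :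
    ∀ t ∈ Set.Icc 0 T, max (u t) (v t) ≤ Real.exp (-c * t) * max (u 0) (v 0) := by
  have hexp (t : ℝ) : HasDerivWithinAt (fun s => Real.exp (c * s)) (Real.exp (c * t) * c)
      (Icc 0 T) t := by
    simpa using ((hasDerivAt_id t).const_mul c).exp.hasDerivWithinAt
  have key := max_le_max_left_endpoint (fun t ht => (hexp t).mul (hu t ht))
    (fun t ht => (hexp t).mul (hv t ht))
    (fun t ht h => by
      have := hu_decay t ht (le_of_mul_le_mul_left h (Real.exp_pos _))
      nlinarith [Real.exp_pos (c * t)])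
    (fun t ht h => by
      have := hv_decay t ht (le_of_mul_le_mul_left h (Real.exp_pos _))
      nlinarith [Real.exp_pos (c * t)])
  intro t ht
  have h := key t ht
  simp only [Pi.mul_apply, mul_zero, Real.exp_zero, one_mul] at h
  rwa [← mul_max_of_nonneg _ _ (Real.exp_pos _).le, ← le_inv_mul_iff₀ (Real.exp_pos _),
    ← Real.exp_neg, ← neg_mul] at h
end
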